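/- Let M be a nonempty message space. There exist two two-party operation sequences σ₁ and σ₂ whose subsequences of Send operations are identical (the same list of (party, message) pairs in the same order) but whose causality graphs differ: G(σ₁) ≠ G(σ₂). Consequently, for every function J mapping lists of Send operations to causality graphs, there exists a two-party operation sequence σ such that J applied to the subsequence of Send operations of σ does not equal G(σ). -/

import Mathlib

namespace TF

inductive ActionType : Type
  | S
  | R
  deriving DecidableEq

structure Vertex (M : Type) where
  t : ActionType
  cs : ℕ
  cr : ℕ
  m : M

inductive Op (M : Type) : Type
  | send (P : Fin 2) (m : M)
  | recv (P : Fin 2) (i : ℕ)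

structure Graph (M : Type) where
  V : Fin 2 → Set (Vertex M)
  E : Set (Vertex M × Vertex M)

structure BuildState (M : Type) where
  cs : Fin 2 → ℕ
  cr : Fin 2 → ℕ
  V : Fin 2 → Set (Vertex M)
  E : Set (Vertex M × Vertex M)
  sends : Fin 2 → List (Vertex M)

variable {M : Type}

def initState : BuildState M :=
  ⟨fun _ => 0, fun _ => 0, fun _ => ∅, ∅, fun _ => []⟩

/-- One construction step of the causality graph. -/
def step (st : BuildState M) : Op M → BuildState M
  | .send P m =>
      let v : Vertex M := ⟨.S, st.cs P + 1, st.cr P, m⟩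
      { st with
          cs := Function.update st.cs P (st.cs P + 1)
          V := Function.update st.V P (insert v (st.V P))
          sends := Function.update st.sends P (st.sends P ++ [v]) }
  | .recv P i =>
      match (st.sends (1 - P))[i - 1]? with
      | some vs =>
          let v : Vertex M := ⟨.R, st.cs P, st.cr P + 1, vs.m⟩
          { st with
              cr := Function.update st.cr P (st.cr P + 1)
              V := Function.update st.V P (insert v (st.V P))
              E := insert (vs, v) st.E }
      | none => st

def buildState (σ : List (Op M)) : BuildState M :=
  σ.foldl step initState

/-- The causality graph `G(σ)` of an operation sequence `σ`. -/
def CG (σ : List (Op M)) : Graph M :=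
  ⟨(buildState σ).V, (buildState σ).E⟩

/-- Number of `Send(P, ·)` operations in `σ`. -/
def sendCount (P : Fin 2) (σ : List (Op M)) : ℕ :=
  σ.countP (fun o => match o with | .send Q _ => decide (Q = P) | _ => false)

/-- Number of `Recv(P, ·)` operations in `σ`. -/
def recvCount (P : Fin 2) (σ : List (Op M)) : ℕ :=
  σ.countP (fun o => match o with | .recv Q _ => decide (Q = P) | _ => false)

/-- Well-formedness of a two-party operation sequence: whenever `Recv(P, i)` occurs,
party `1 - P` has already performed at least `i ≥ 1` send operations. -/
def WF (σ : List (Op M)) : Prop :=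
  ∀ k (P : Fin 2) (i : ℕ), σ[k]? = some (.recv P i) →
    1 ≤ i ∧ i ≤ sendCount (1 - P) (σ.take k)

def ValidGraph (G : Graph M) : Prop := ∃ σ : List (Op M), WF σ ∧ G = CG σ

def Subgraph (G' G : Graph M) : Prop :=
  (∀ P, G'.V P ⊆ G.V P) ∧ G'.E ⊆ G.E

def ValidSub (G' : Graph M) : Prop := ∃ G : Graph M, ValidGraph G ∧ Subgraph G' G

def Consistent (G₁ G₂ : Graph M) : Prop :=
  ∃ G : Graph M, ValidGraph G ∧ Subgraph G₁ G ∧ Subgraph G₂ G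

/-- Message-excluded vertices: triples (type, cs, cr). -/
abbrev EVertex := ActionType × ℕ × ℕ

structure EGraph where
  V : Fin 2 → Set EVertex
  E : Set (EVertex × EVertex)

def eraseV (v : Vertex M) : EVertex := (v.t, v.cs, v.cr)

/-- The message-excluded version of a causality graph. -/
def eraseG (G : Graph M) : EGraph :=
  ⟨fun P => eraseV '' G.V P, (fun e => (eraseV e.1, eraseV e.2)) '' G.E⟩

def ESubgraph (G' G : EGraph) : Prop :=
  (∀ P, G'.V P ⊆ G.V P) ∧ G'.E ⊆ G.E

def EValid (H : EGraph) : Prop := ∃ G : Graph M, ValidGraph G ∧ H = eraseG G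

def EConsistent (H₁ H₂ : EGraph) : Prop :=
  ∃ H : EGraph, EValid (M := M) H ∧ ESubgraph H₁ H ∧ ESubgraph H₂ H

/-- `v` strictly precedes `v'` in the per-party order. -/
def sprec (v v' : Vertex M) : Prop :=
  v.cs ≤ v'.cs ∧ v.cr ≤ v'.cr ∧ (v.cs, v.cr) ≠ (v'.cs, v'.cr)

/-- The causality relation: transitive closure of the per-party strict orders
together with the edge relation. -/
def causal (G : Graph M) : Vertex M → Vertex M → Prop :=
  Relation.TransGen
    (fun a b => (∃ P, a ∈ G.V P ∧ b ∈ G.V P ∧ sprec a b) ∨ (a, b) ∈ G.E)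

/-- The vertex `v` of party `P` is created by the `k`-th operation of `σ`. -/
def createdAt (σ : List (Op M)) (P : Fin 2) (v : Vertex M) (k : ℕ) : Prop :=
  v ∈ (buildState (σ.take (k + 1))).V P ∧ v ∉ (buildState (σ.take k)).V P

/-- The subsequence of send operations of `σ`, as (party, message) pairs. -/
def sendsOf (σ : List (Op M)) : List (Fin 2 × M) :=
  σ.filterMap (fun o => match o with | .send P m => some (P, m) | _ => none)

theorem wf_send (m : M) : WF [Op.send 0 m] := by
  intro k P i h
  match k with
  | 0 => simp at h
  | k + 1 => simp at h

theorem wf_send_recv (m : M) : WF [Op.send 0 m, Op.recv 1 1] := by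
  intro k P i h
  match k with
  | 0 => simp at h
  | 1 =>
    simp only [List.getElem?_cons_succ, List.getElem?_cons_zero, Option.some.injEq,
      Op.recv.injEq] at h
    obtain ⟨rfl, rfl⟩ := h
    simp [sendCount]
  | k + 2 => simp at h

theorem CG_send_ne_CG_send_recv (m : M) :
    CG [Op.send 0 m] ≠ CG [Op.send 0 m, Op.recv 1 1] := by
  intro h
  have hE := congrArg Graph.E h
  simp [CG, buildState, step, initState] at hE

theorem sends_do_not_determine_graph {M : Type} [Nonempty M] :
    (∃ σ₁ σ₂ : List (Op M), WF σ₁ ∧ WF σ₂ ∧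
      sendsOf σ₁ = sendsOf σ₂ ∧ CG σ₁ ≠ CG σ₂) ∧
    (∀ J : List (Fin 2 × M) → Graph M,
      ∃ σ : List (Op M), WF σ ∧ J (sendsOf σ) ≠ CG σ) := by
  obtain ⟨m⟩ := ‹Nonempty M›
  refine ⟨⟨_, _, wf_send m, wf_send_recv m, rfl, CG_send_ne_CG_send_recv m⟩, fun J => ?_⟩
  by_cases h : J (sendsOf [Op.send 0 m]) = CG [Op.send 0 m]
  · exact ⟨_, wf_send_recv m, fun h' => CG_send_ne_CG_send_recv m (h.symm.trans h')⟩
  · exact ⟨_, wf_send m, h⟩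

end TF
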